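/- For every S ∈ St(d,p)^{⊗n}, the chain of inequalities (n/2)·d_F(S,Z)² ≤ n²d − ‖ZᵀS‖_F² ≤ n·d_F(S,Z)² holds, where ZᵀS = Σ_{j=1}^n S_j ∈ ℝ^{d×p}. -/

import Mathlib

open Matrix MeasureTheory ProbabilityTheory
open scoped BigOperators ENNReal

noncomputable section

/-- Frobenius inner product `⟨X, Y⟩ = Tr (X Yᵀ)`. -/
def finner {m k : Type*} [Fintype m] [Fintype k] (X Y : Matrix m k ℝ) : ℝ :=
  ∑ i, ∑ j, X i j * Y i j

/-- Frobenius norm. -/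
def frobNorm {m k : Type*} [Fintype m] [Fintype k] (X : Matrix m k ℝ) : ℝ :=
  Real.sqrt (∑ i, ∑ j, (X i j) ^ 2)

/-- Spectral (ℓ²-operator) norm of a real matrix. -/
def opNorm {m k : Type*} [Fintype m] [Fintype k] [DecidableEq k] (X : Matrix m k ℝ) : ℝ :=
  ‖LinearMap.toContinuousLinearMap (Matrix.toEuclideanLin X)‖

/-- The `(i,j)` d×d block of an (nd)×(nd) matrix. -/
def blk {n d : ℕ} (M : Matrix (Fin n × Fin d) (Fin n × Fin d) ℝ) (i j : Fin n) :
    Matrix (Fin d) (Fin d) ℝ := fun k l => M (i, k) (j, l)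

/-- The i-th d×p block row of an (nd)×p matrix. -/
def rowBlk {n d p : ℕ} (S : Matrix (Fin n × Fin d) (Fin p) ℝ) (i : Fin n) :
    Matrix (Fin d) (Fin p) ℝ := fun k l => S (i, k) l

/-- The i-th (nd)×d block column of an (nd)×(nd) matrix. -/
def colBlk {n d : ℕ} (M : Matrix (Fin n × Fin d) (Fin n × Fin d) ℝ) (i : Fin n) :
    Matrix (Fin n × Fin d) (Fin d) ℝ := fun q l => M q (i, l)

/-- All d×p block rows lie in the Stiefel manifold St(d,p) (for p = d: are orthogonal). -/
def StiefelBlocks {n d p : ℕ} (S : Matrix (Fin n × Fin d) (Fin p) ℝ) : Prop :=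
  ∀ i, rowBlk S i * (rowBlk S i)ᵀ = 1

/-- The vertical stack Z of n copies of the identity I_d. -/
def Zmat (n d : ℕ) : Matrix (Fin n × Fin d) (Fin d) ℝ := fun q l => if q.2 = l then 1 else 0

/-- Feasibility for the SDP relaxation: symmetric, PSD, identity diagonal blocks. -/
def sdpFeasible {n d : ℕ} (X : Matrix (Fin n × Fin d) (Fin n × Fin d) ℝ) : Prop :=
  X.IsSymm ∧ X.PosSemidef ∧ ∀ i, blk X i i = 1

/-- Global maximizer of the SDP relaxation with data `A`. -/
def sdpMaximizer {n d : ℕ} (A X : Matrix (Fin n × Fin d) (Fin n × Fin d) ℝ) : Prop :=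
  sdpFeasible X ∧ ∀ Y, sdpFeasible Y → finner A Y ≤ finner A X

/-- Global maximizer of the program (P) with data `A`. -/
def progPMaximizer {n d : ℕ} (A : Matrix (Fin n × Fin d) (Fin n × Fin d) ℝ)
    (R : Matrix (Fin n × Fin d) (Fin d) ℝ) : Prop :=
  StiefelBlocks R ∧
    ∀ R' : Matrix (Fin n × Fin d) (Fin d) ℝ, StiefelBlocks R' →
      finner A (R' * R'ᵀ) ≤ finner A (R * Rᵀ)

/-- The distance `d_F(S, Z) = min_{Q ∈ St(d,p)} ‖S − ZQ‖_F`. -/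
def dF {n d p : ℕ} (S : Matrix (Fin n × Fin d) (Fin p) ℝ) : ℝ :=
  sInf {c | ∃ Q : Matrix (Fin d) (Fin p) ℝ, Q * Qᵀ = 1 ∧ c = frobNorm (S - Zmat n d * Q)}

/-- `Λ_{ii}(S) = (1/2) Σ_j (S_i S_jᵀ A_{ji} + A_{ij} S_j S_iᵀ)`. -/
def Lam {n d p : ℕ} (A : Matrix (Fin n × Fin d) (Fin n × Fin d) ℝ)
    (S : Matrix (Fin n × Fin d) (Fin p) ℝ) (i : Fin n) : Matrix (Fin d) (Fin d) ℝ :=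
  (1 / 2 : ℝ) •
    ∑ j, (rowBlk S i * (rowBlk S j)ᵀ * blk A j i + blk A i j * rowBlk S j * (rowBlk S i)ᵀ)

/-- Block diagonal matrix with given d×d diagonal blocks. -/
def blkDiag {n d : ℕ} (D : Fin n → Matrix (Fin d) (Fin d) ℝ) :
    Matrix (Fin n × Fin d) (Fin n × Fin d) ℝ :=
  fun q r => if q.1 = r.1 then D q.1 q.2 r.2 else 0

/-- Local maximizer of `f(S) = ⟨A, S Sᵀ⟩` over `St(d,p)^{⊗n}`. -/
def isLocalMax {n d p : ℕ} (A : Matrix (Fin n × Fin d) (Fin n × Fin d) ℝ)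
    (S : Matrix (Fin n × Fin d) (Fin p) ℝ) : Prop :=
  StiefelBlocks S ∧ ∃ ε > (0 : ℝ), ∀ S' : Matrix (Fin n × Fin d) (Fin p) ℝ,
    StiefelBlocks S' → frobNorm (S' - S) < ε → finner A (S' * S'ᵀ) ≤ finner A (S * Sᵀ)

/-- First-order criticality: `Σ_j A_{ij} S_j = Λ_{ii}(S) S_i` for all i. -/
def firstOrderCrit {n d p : ℕ} (A : Matrix (Fin n × Fin d) (Fin n × Fin d) ℝ)
    (S : Matrix (Fin n × Fin d) (Fin p) ℝ) : Prop :=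
  ∀ i, (∑ j, blk A i j * rowBlk S j) = Lam A S i * rowBlk S i

/-- Second-order necessary inequality over tangent directions. -/
def secondOrderIneq {n d p : ℕ} (A : Matrix (Fin n × Fin d) (Fin n × Fin d) ℝ)
    (S : Matrix (Fin n × Fin d) (Fin p) ℝ) : Prop :=
  ∀ Y : Matrix (Fin n × Fin d) (Fin p) ℝ,
    (∀ i, rowBlk S i * (rowBlk Y i)ᵀ + rowBlk Y i * (rowBlk S i)ᵀ = 0) →
    ∑ i, ∑ j, finner (blk A i j) (rowBlk Y i * (rowBlk Y j)ᵀ) ≤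
      ∑ i, finner (Lam A S i) (rowBlk Y i * (rowBlk Y i)ᵀ)

/-- Second-order critical point of `f`. -/
def secondOrderCrit {n d p : ℕ} (A : Matrix (Fin n × Fin d) (Fin n × Fin d) ℝ)
    (S : Matrix (Fin n × Fin d) (Fin p) ℝ) : Prop :=
  StiefelBlocks S ∧ firstOrderCrit A S ∧ secondOrderIneq A S

/-- Partial trace `Tr_d(Δ) ∈ ℝ^{n×n}`. -/
def partialTrace {n d : ℕ} (Δ : Matrix (Fin n × Fin d) (Fin n × Fin d) ℝ) :
    Matrix (Fin n) (Fin n) ℝ := fun i j => (blk Δ i j).trace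

/-- Singular values of a d×p real matrix (square roots of the eigenvalues of `M Mᴴ`). -/
def singVals {d p : ℕ} (M : Matrix (Fin d) (Fin p) ℝ) (i : Fin d) : ℝ :=
  Real.sqrt ((Matrix.isHermitian_mul_conjTranspose_self M).eigenvalues i)

/-- Nuclear norm: sum of singular values. -/
def nuclearNorm {d p : ℕ} (M : Matrix (Fin d) (Fin p) ℝ) : ℝ :=
  ∑ i, singVals M i

/-- The law of the iid standard Gaussian coordinates indexing the noise. -/
def gaussianEnsemble (n d : ℕ) :
    Measure (((Fin n × Fin d) × (Fin n × Fin d)) → ℝ) :=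
  Measure.pi fun _ => gaussianReal 0 1

/-- The symmetric Gaussian random matrix `W` built from the iid coordinates:
`W_{ii} = 0`, the entries of `W_{ij}` for `i < j` are iid standard Gaussians, and
`W_{ji} = W_{ij}ᵀ`. -/
def Wof {n d : ℕ} (ω : ((Fin n × Fin d) × (Fin n × Fin d)) → ℝ) :
    Matrix (Fin n × Fin d) (Fin n × Fin d) ℝ :=
  fun q r => if q.1 < r.1 then ω (q, r) else if r.1 < q.1 then ω (r, q) else 0

lemma frobNorm_nonneg {m k : Type*} [Fintype m] [Fintype k] (X : Matrix m k ℝ) :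
    0 ≤ frobNorm X :=
  Real.sqrt_nonneg _

lemma frobNorm_sq {m k : Type*} [Fintype m] [Fintype k] (X : Matrix m k ℝ) :
    frobNorm X ^ 2 = finner X X := by
  rw [frobNorm, Real.sq_sqrt (by positivity), finner]
  simp only [sq]

lemma finner_self_nonneg {m k : Type*} [Fintype m] [Fintype k] (X : Matrix m k ℝ) :
    0 ≤ finner X X :=
  frobNorm_sq X ▸ sq_nonneg _

lemma finner_eq_trace {m k : Type*} [Fintype m] [Fintype k] (X Y : Matrix m k ℝ) :
    finner X Y = (X * Yᵀ).trace := by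
  simp [finner, Matrix.trace, Matrix.mul_apply]

lemma finner_comm {m k : Type*} [Fintype m] [Fintype k] (X Y : Matrix m k ℝ) :
    finner X Y = finner Y X := by
  simp only [finner, mul_comm]

lemma finner_sub_self {m k : Type*} [Fintype m] [Fintype k] (X Y : Matrix m k ℝ) :
    finner (X - Y) (X - Y) = finner X X - 2 * finner X Y + finner Y Y := by
  have h := finner_comm X Y
  simp only [finner_eq_trace] at h ⊢
  simp only [Matrix.transpose_sub, Matrix.sub_mul, Matrix.mul_sub, Matrix.trace_sub]
  linarith

lemma finner_sum_left {ι m k : Type*} [Fintype m] [Fintype k] (s : Finset ι)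
    (X : ι → Matrix m k ℝ) (Y : Matrix m k ℝ) :
    finner (∑ i ∈ s, X i) Y = ∑ i ∈ s, finner (X i) Y := by
  simp only [finner_eq_trace, Matrix.sum_mul, Matrix.trace_sum]

lemma finner_self_of_mul_transpose_eq_one {d p : ℕ} {Q : Matrix (Fin d) (Fin p) ℝ}
    (hQ : Q * Qᵀ = 1) : finner Q Q = d := by
  simp [finner_eq_trace, hQ]

lemma transpose_Zmat_mul {n d p : ℕ} (S : Matrix (Fin n × Fin d) (Fin p) ℝ) :
    (Zmat n d)ᵀ * S = ∑ i, rowBlk S i := by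
  ext k l
  simp [Matrix.mul_apply, Matrix.sum_apply, Zmat, rowBlk, Fintype.sum_prod_type]

lemma rowBlk_sub_Zmat_mul {n d p : ℕ} (S : Matrix (Fin n × Fin d) (Fin p) ℝ)
    (Q : Matrix (Fin d) (Fin p) ℝ) (i : Fin n) :
    rowBlk (S - Zmat n d * Q) i = rowBlk S i - Q := by
  ext k l
  simp [Matrix.mul_apply, Zmat, rowBlk]

lemma frobNorm_sq_eq_sum_rowBlk {n d p : ℕ} (S : Matrix (Fin n × Fin d) (Fin p) ℝ) :
    frobNorm S ^ 2 = ∑ i, finner (rowBlk S i) (rowBlk S i) := by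
  simp [frobNorm_sq, finner, rowBlk, Fintype.sum_prod_type]

/-- On the Stiefel manifold, the squared distance to `ZQ` is affine in `Q`. -/
lemma frobNorm_sub_Zmat_mul_sq {n d p : ℕ} {S : Matrix (Fin n × Fin d) (Fin p) ℝ}
    (hS : StiefelBlocks S) {Q : Matrix (Fin d) (Fin p) ℝ} (hQ : Q * Qᵀ = 1) :
    frobNorm (S - Zmat n d * Q) ^ 2 = 2 * n * d - 2 * finner ((Zmat n d)ᵀ * S) Q := by
  simp only [frobNorm_sq_eq_sum_rowBlk, rowBlk_sub_Zmat_mul, finner_sub_self,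
    finner_self_of_mul_transpose_eq_one (hS _), finner_self_of_mul_transpose_eq_one hQ,
    transpose_Zmat_mul, finner_sum_left, Finset.sum_add_distrib, Finset.sum_sub_distrib,
    ← Finset.mul_sum]
  simp
  ring

lemma dF_nonneg {n d p : ℕ} (S : Matrix (Fin n × Fin d) (Fin p) ℝ) : 0 ≤ dF S :=
  Real.sInf_nonneg (by rintro _ ⟨Q, -, rfl⟩; exact frobNorm_nonneg _)

lemma dF_le {n d p : ℕ} (S : Matrix (Fin n × Fin d) (Fin p) ℝ) {Q : Matrix (Fin d) (Fin p) ℝ}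
    (hQ : Q * Qᵀ = 1) : dF S ≤ frobNorm (S - Zmat n d * Q) :=
  csInf_le ⟨0, by rintro _ ⟨Q, -, rfl⟩; exact frobNorm_nonneg _⟩ ⟨Q, hQ, rfl⟩

/-- Some block correlates with the block sum at least as well as the average block does. -/
lemma exists_finner_self_le_mul_finner_rowBlk {n d p : ℕ} (hn : 0 < n)
    (S : Matrix (Fin n × Fin d) (Fin p) ℝ) :
    ∃ j, finner ((Zmat n d)ᵀ * S) ((Zmat n d)ᵀ * S) ≤
      n * finner ((Zmat n d)ᵀ * S) (rowBlk S j) := by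
  set M := (Zmat n d)ᵀ * S with hM
  have : Nonempty (Fin n) := ⟨⟨0, hn⟩⟩
  obtain ⟨j, hj⟩ := Finite.exists_max fun j => finner M (rowBlk S j)
  refine ⟨j, ?_⟩
  calc finner M M = ∑ i, finner M (rowBlk S i) := by
        conv_lhs => rw [hM, transpose_Zmat_mul, finner_sum_left, ← transpose_Zmat_mul, ← hM]
        simp only [finner_comm M]
    _ ≤ ∑ _i : Fin n, finner M (rowBlk S j) := Finset.sum_le_sum fun i _ => hj i
    _ = n * finner M (rowBlk S j) := by simp

lemma sq_mul_sub_frobNorm_sq_le {n d p : ℕ} {S : Matrix (Fin n × Fin d) (Fin p) ℝ}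
    (hS : StiefelBlocks S) {Q : Matrix (Fin d) (Fin p) ℝ} (hQ : Q * Qᵀ = 1) :
    (n : ℝ) ^ 2 * d - frobNorm ((Zmat n d)ᵀ * S) ^ 2 ≤
      n * frobNorm (S - Zmat n d * Q) ^ 2 := by
  have h := finner_self_nonneg ((Zmat n d)ᵀ * S - (n : ℝ) • Q)
  have hd := finner_self_of_mul_transpose_eq_one hQ
  rw [finner_sub_self] at h
  rw [frobNorm_sub_Zmat_mul_sq hS hQ, frobNorm_sq]
  simp only [finner_eq_trace, Matrix.transpose_smul, Matrix.smul_mul, Matrix.mul_smul,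
    Matrix.trace_smul, smul_eq_mul] at h hd ⊢
  rw [hd] at h
  linarith

/-- `(n/2)·d_F(S,Z)² ≤ n²d − ‖ZᵀS‖_F² ≤ n·d_F(S,Z)²`. -/
theorem dF_squared_bounds {n d p : ℕ} (hn : 2 ≤ n) (hd : 1 ≤ d) (hp : d ≤ p)
    (S : Matrix (Fin n × Fin d) (Fin p) ℝ) (hS : StiefelBlocks S) :
    (n : ℝ) / 2 * dF S ^ 2 ≤ (n : ℝ) ^ 2 * d - frobNorm ((Zmat n d)ᵀ * S) ^ 2 ∧
    (n : ℝ) ^ 2 * d - frobNorm ((Zmat n d)ᵀ * S) ^ 2 ≤ (n : ℝ) * dF S ^ 2 := by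
  have hn0 : (0 : ℝ) < n := by exact_mod_cast (by omega : 0 < n)
  obtain ⟨j, hj⟩ := exists_finner_self_le_mul_finner_rowBlk (by omega) S
  constructor
  · have h := pow_le_pow_left₀ (dF_nonneg S) (dF_le S (hS j)) 2
    rw [frobNorm_sub_Zmat_mul_sq hS (hS j)] at h
    rw [frobNorm_sq]
    linarith [mul_le_mul_of_nonneg_left h (by positivity : (0 : ℝ) ≤ n / 2)]
  · set B := (n : ℝ) ^ 2 * d - frobNorm ((Zmat n d)ᵀ * S) ^ 2 with hB
    have h : √(B / n) ≤ dF S := by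
      refine le_csInf ⟨_, _, hS j, rfl⟩ ?_
      rintro _ ⟨Q, hQ, rfl⟩
      refine Real.sqrt_le_iff.mpr ⟨frobNorm_nonneg _, ?_⟩
      rw [div_le_iff₀' hn0]
      exact sq_mul_sub_frobNorm_sq_le hS hQ
    rw [← div_le_iff₀' hn0]
    exact (Real.sqrt_le_iff.mp h).2
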